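/- For every cubic form F ∈ 𝒰 (i.e., F ∈ ℂ[x₀,…,x₄] smooth of degree 3 with (J_{F,3})^⊥ containing a smooth cubic), there exists a quadratic form Q ∈ S_2 such that: (i) the pair (F,Q) defines a smooth complete intersection surface in ℙ⁴, and (ii) the subspace ((J_{F,5}:Q))^⊥ of S_3 is one-dimensional and is spanned by a smooth cubic form. (Theorem 1.3, algebraic form of the smoothness of the associated cubic C, using ℂC = (J_{F,5}:Q)^⊥.) -/

import Mathlib

open MvPolynomial

/-- `F` is smooth: the only common zero of its partial derivatives is the origin. -/
def SmoothForm {N : ℕ} (F : MvPolynomial (Fin N) ℂ) : Prop :=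
  ∀ x : Fin N → ℂ, (∀ i, eval x (pderiv i F) = 0) → x = 0

/-- The Jacobian ideal of `F`. -/
noncomputable def jacobianIdeal {N : ℕ} (F : MvPolynomial (Fin N) ℂ) :
    Ideal (MvPolynomial (Fin N) ℂ) :=
  Ideal.span (Set.range fun i => pderiv i F)

/-- `J_{F,k} = J_F ∩ S_k`. -/
def Jpart {N : ℕ} (F : MvPolynomial (Fin N) ℂ) (k : ℕ) : Set (MvPolynomial (Fin N) ℂ) :=
  {b | b ∈ jacobianIdeal F ∧ b ∈ homogeneousSubmodule (Fin N) ℂ k}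

/-- The polar pairing `⟨P, G⟩ = G(∂/∂x₀,…)P`, as a constant. -/
noncomputable def polarPair {N : ℕ} (P G : MvPolynomial (Fin N) ℂ) : ℂ :=
  constantCoeff (∑ m ∈ G.support, G.coeff m •
    ((List.ofFn fun i : Fin N =>
      ((pderiv i).toLinearMap : Module.End ℂ (MvPolynomial (Fin N) ℂ)) ^ (m i)).prod P))

/-- `E^⊥ = {G ∈ S₃ : ⟨b, G⟩ = 0 for all b ∈ E}`. -/
def perp {N : ℕ} (E : Set (MvPolynomial (Fin N) ℂ)) : Set (MvPolynomial (Fin N) ℂ) :=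
  {G | G ∈ homogeneousSubmodule (Fin N) ℂ 3 ∧ ∀ b ∈ E, polarPair b G = 0}

/-- The set `𝒰` of smooth cubic forms `F` such that `(J_{F,3})^⊥` contains a smooth cubic. -/
def calU : Set (MvPolynomial (Fin 5) ℂ) :=
  {F | F ∈ homogeneousSubmodule (Fin 5) ℂ 3 ∧ SmoothForm F ∧
    ∃ G, G ∈ perp (Jpart F 3) ∧ SmoothForm G}

/-- `(F, Q)` defines a smooth complete intersection: at every nonzero common zero `p` of
`F` and `Q` the gradients `∇F(p)` and `∇Q(p)` are linearly independent. -/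
def SmoothCI (F Q : MvPolynomial (Fin 5) ℂ) : Prop :=
  ∀ p : Fin 5 → ℂ, p ≠ 0 → eval p F = 0 → eval p Q = 0 →
    LinearIndependent ℂ ![fun i => eval p (pderiv i F), fun i => eval p (pderiv i Q)]

/-- The colon space `(J_{F,5} : Q) = {b ∈ S₃ : bQ ∈ J_{F,5}}`. -/
def colonFive (F Q : MvPolynomial (Fin 5) ℂ) : Set (MvPolynomial (Fin 5) ℂ) :=
  {b | b ∈ homogeneousSubmodule (Fin 5) ℂ 3 ∧ b * Q ∈ Jpart F 5}

/-! ### Regular sequences and socles -/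

/-- `g` is a nonzerodivisor modulo `I`. -/
def RegMod {R : Type*} [CommRing R] (I : Ideal R) (g : R) : Prop := ∀ u, g * u ∈ I → u ∈ I

/-- The ideal generated by `I` and the elements of a list. -/
def lid {R : Type*} [CommRing R] : Ideal R → List R → Ideal R
  | I, [] => I
  | I, g :: l => lid (I ⊔ Ideal.span {g}) l

/-- The list is a (weakly) regular sequence modulo `I`. -/
def RegSeq {R : Type*} [CommRing R] : Ideal R → List R → Prop
  | _, [] => True
  | I, g :: l => RegMod I g ∧ RegSeq (I ⊔ Ideal.span {g}) l

section general
variable {R : Type*} [CommRing R]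

theorem lid_append (I : Ideal R) (l l' : List R) : lid I (l ++ l') = lid (lid I l) l' := by
  induction l generalizing I with
  | nil => rfl
  | cons g l ih => exact ih _

theorem regSeq_append (I : Ideal R) (l l' : List R) :
    RegSeq I (l ++ l') ↔ RegSeq I l ∧ RegSeq (lid I l) l' := by
  induction l generalizing I with
  | nil => simp [RegSeq, lid]
  | cons g l ih => simp [RegSeq, lid, ih, and_assoc]

theorem lid_sup (I K : Ideal R) (l : List R) : lid (I ⊔ K) l = lid I l ⊔ K := by
  induction l generalizing I with
  | nil => rfl
  | cons g l ih =>
    simp only [lid]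
    rw [← ih, sup_right_comm]

theorem lid_le (I K : Ideal R) (l : List R) (hI : I ≤ K) (hl : ∀ g ∈ l, g ∈ K) : lid I l ≤ K := by
  induction l generalizing I with
  | nil => exact hI
  | cons g l ih =>
    refine ih _ (sup_le hI ?_) (fun x hx => hl x (by simp [hx]))
    rw [Ideal.span_singleton_le_iff_mem]
    exact hl g (by simp)

theorem le_lid (I : Ideal R) (l : List R) : I ≤ lid I l := by
  induction l generalizing I with
  | nil => exact le_rfl
  | cons g l ih => exact le_trans le_sup_left (ih _)

theorem mem_lid (I : Ideal R) (l : List R) (g : R) (hg : g ∈ l) : g ∈ lid I l := by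
  induction l generalizing I with
  | nil => simp at hg
  | cons a l ih =>
    rcases List.mem_cons.1 hg with rfl | h
    · exact le_lid (I ⊔ Ideal.span {g}) l
        (Ideal.mem_sup_right (Ideal.mem_span_singleton_self _))
    · exact ih _ h

theorem mem_sup_span {I : Ideal R} {z u : R} :
    u ∈ I ⊔ Ideal.span {z} ↔ ∃ t, u - z * t ∈ I := by
  rw [sup_comm, Ideal.mem_span_singleton_sup]
  constructor
  · rintro ⟨a, b, hb, rfl⟩
    exact ⟨a, by convert hb using 1; ring⟩
  · rintro ⟨t, ht⟩
    exact ⟨t, _, ht, by ring⟩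

theorem regSeq_insert (I : Ideal R) (l : List R) (z : R) (hl : RegSeq I l)
    (hz : ∀ p, p <+: l → RegMod (lid I p) z) : RegSeq (I ⊔ Ideal.span {z}) l := by
  induction l generalizing I with
  | nil => trivial
  | cons g l ih =>
    obtain ⟨hg, hl⟩ := hl
    have hz0 : RegMod I z := hz [] (by simp)
    have hz1 : RegMod (I ⊔ Ideal.span {g}) z := hz [g] (by simp)
    refine ⟨?_, ?_⟩
    · intro u hu
      obtain ⟨v, hv⟩ := mem_sup_span.1 hu
      have h1 : v ∈ I ⊔ Ideal.span {g} := by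
        apply hz1
        rw [mem_sup_span]
        refine ⟨u, ?_⟩
        rw [← neg_mem_iff]; convert hv using 1; ring
      obtain ⟨w, hw⟩ := mem_sup_span.1 h1
      rw [mem_sup_span]
      refine ⟨w, hg _ ?_⟩
      have := I.add_mem hv (I.mul_mem_left z hw)
      convert this using 1; ring
    · rw [sup_right_comm]
      apply ih _ hl
      intro p hp
      exact hz (g :: p) (by simpa using hp)

/-- The socle of `R/I` (relative to `m`) is zero. -/
def NoSoc (m I : Ideal R) : Prop := ∀ u, (∀ c ∈ m, c * u ∈ I) → u ∈ I

theorem soc_transfer {m I : Ideal R} {a b u v : R} (hb : RegMod I b)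
    (hu : ∀ c ∈ m, c * u ∈ I ⊔ Ideal.span {b}) (hv : a * u - b * v ∈ I) :
    ∀ c ∈ m, c * v ∈ I ⊔ Ideal.span {a} := by
  intro c hc
  obtain ⟨w, hw⟩ := mem_sup_span.1 (hu c hc)
  rw [mem_sup_span]
  refine ⟨w, hb _ ?_⟩
  have := I.sub_mem (I.mul_mem_left a hw) (I.mul_mem_left c hv)
  convert this using 1; ring

theorem noSoc_swap {m I : Ideal R} {a b : R} (ham : a ∈ m) (ha : RegMod I a) (hb : RegMod I b)
    (h : NoSoc m (I ⊔ Ideal.span {a})) : NoSoc m (I ⊔ Ideal.span {b}) := by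
  intro u hu
  obtain ⟨v, hv⟩ := mem_sup_span.1 (hu a ham)
  have := h v (soc_transfer hb hu hv)
  obtain ⟨t, ht⟩ := mem_sup_span.1 this
  rw [mem_sup_span]
  refine ⟨t, ha _ ?_⟩
  have := I.add_mem hv (I.mul_mem_left b ht)
  convert this using 1; ring

theorem exists_regMod {k : Type*} [Field k] [Infinite k] [Algebra k R] [IsNoetherianRing R]
    (m : Ideal R) (W : Submodule k R)
    (hW : ∀ P : Ideal R, P.IsPrime → (∀ w ∈ W, w ∈ P) → m ≤ P)
    {ι : Type*} [Finite ι] (I : ι → Ideal R) (hI : ∀ i, NoSoc m (I i)) :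
    ∃ w ∈ W, ∀ i, RegMod (I i) w := by
  have hfin : ∀ i, Finite (associatedPrimes R (R ⧸ I i)) := fun i =>
    (associatedPrimes.finite R (R ⧸ I i)).to_subtype
  let p : (Σ i, associatedPrimes R (R ⧸ I i)) → Submodule k W := fun x =>
    (x.2.1.restrictScalars k).comap W.subtype
  obtain ⟨w, hw⟩ := Submodule.exists_forall_notMem_of_forall_ne_top p (by
    rintro ⟨i, P, hP⟩ htop
    have hmP : m ≤ P := by
      apply hW P hP.isPrime
      intro w hw
      have : (⟨w, hw⟩ : W) ∈ p ⟨i, P, hP⟩ := by rw [htop]; trivial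
      exact this
    obtain ⟨hPp, x, hx⟩ := isAssociatedPrime_iff.1 hP
    obtain ⟨u, rfl⟩ := Ideal.Quotient.mk_surjective x
    have hu : u ∈ I i := by
      apply hI i
      intro c hc
      have := hmP hc
      rw [hx, Submodule.mem_colon_singleton] at this
      rw [← Ideal.Quotient.eq_zero_iff_mem, map_mul]
      simpa [Algebra.smul_def] using this
    apply hPp.ne_top
    rw [hx, Ideal.Quotient.eq_zero_iff_mem.2 hu]
    ext; simp)
  refine ⟨w, w.2, fun i u hu => ?_⟩
  by_contra hui
  have : (w : R) ∈ ⋃ p ∈ associatedPrimes R (R ⧸ I i), (p : Set R) := by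
    rw [biUnion_associatedPrimes_eq_zero_divisors]
    refine ⟨Ideal.Quotient.mk _ u, ?_, ?_⟩
    · rwa [Ne, Ideal.Quotient.eq_zero_iff_mem]
    · have := Ideal.Quotient.eq_zero_iff_mem.2 hu
      rw [map_mul] at this
      simpa [Algebra.smul_def] using this
  simp only [Set.mem_iUnion] at this
  obtain ⟨P, hP, hwP⟩ := this
  exact hw ⟨i, P, hP⟩ hwP

theorem regSeq_rank {k : Type*} [Field k] [Algebra k R] (m : Ideal R) (hm : m ≠ ⊤)
    (W : Submodule k R) [FiniteDimensional k W] (l : List R) (hlW : ∀ g ∈ l, g ∈ W)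
    (hlm : ∀ g ∈ l, g ∈ m) (hl : RegSeq ⊥ l) :
    ∃ W' : Submodule k R, W' ≤ W ∧ l.length ≤ Module.finrank k W' ∧ ∀ w ∈ W', w ∈ lid ⊥ l := by
  induction l using List.reverseRecOn with
  | nil => exact ⟨⊥, bot_le, by simp, by simp [lid]⟩
  | append_singleton l g ih =>
    rw [regSeq_append] at hl
    obtain ⟨hl, hg, -⟩ := hl
    obtain ⟨W', h1, h2, h3⟩ := ih (fun x hx => hlW x (by simp [hx]))
      (fun x hx => hlm x (by simp [hx])) hl
    have hgn : g ∉ lid ⊥ l := by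
      intro hgl
      apply hm
      rw [Ideal.eq_top_iff_one]
      apply lid_le ⊥ m l bot_le (fun x hx => hlm x (by simp [hx]))
      apply hg
      simpa using hgl
    have hle : W' ⊔ Submodule.span k {g} ≤ W :=
      sup_le h1 (by rw [Submodule.span_singleton_le_iff_mem]; exact hlW g (by simp))
    refine ⟨W' ⊔ Submodule.span k {g}, hle, ?_, ?_⟩
    · have : FiniteDimensional k ↥(W' ⊔ Submodule.span k {g}) :=
        Submodule.finiteDimensional_of_le hle
      have hlt : W' < W' ⊔ Submodule.span k {g} := by
        refine lt_of_le_of_ne le_sup_left fun h => hgn (h3 g ?_)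
        rw [h]
        exact Submodule.mem_sup_right (Submodule.mem_span_singleton_self g)
      have := Submodule.finrank_lt_finrank_of_lt hlt
      simp; omega
    · intro w hw
      rw [lid_append]
      obtain ⟨a, ha, b, hb, rfl⟩ := Submodule.mem_sup.1 hw
      obtain ⟨c, rfl⟩ := Submodule.mem_span_singleton.1 hb
      refine Ideal.add_mem _ (le_lid _ _ (h3 a ha)) ?_
      rw [Algebra.smul_def]
      exact Ideal.mul_mem_left _ _ (mem_lid _ _ _ (by simp))

end general

section poly
variable {n : ℕ}

/-- The irrelevant ideal. -/
noncomputable def mm (n : ℕ) : Ideal (MvPolynomial (Fin n) ℂ) := Ideal.span (Set.range X)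

theorem mm_eval {n : ℕ} {u : MvPolynomial (Fin n) ℂ} (h : u ∈ mm n) : eval 0 u = 0 := by
  have : mm n ≤ RingHom.ker (eval (0 : Fin n → ℂ)) := by
    unfold mm
    rw [Ideal.span_le]
    rintro _ ⟨i, rfl⟩
    simp [RingHom.mem_ker]
  exact this h

theorem mm_ne_top : mm n ≠ ⊤ := by
  intro h
  have := mm_eval (n := n) (u := 1) (by rw [h]; trivial)
  simp at this

theorem mem_mm_of_hom {u : MvPolynomial (Fin n) ℂ} {d : ℕ} (hu : u.IsHomogeneous (d + 1)) :
    u ∈ mm n := by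
  unfold mm
  rw [← Set.image_univ, mem_ideal_span_X_image]
  intro m hm
  by_contra hcon
  push Not at hcon
  have h0 : m = 0 := by ext i; simpa using hcon i
  have h1 := hu (mem_support_iff.1 hm)
  rw [h0] at h1
  simp at h1

theorem linear_prime (V : Submodule ℂ (MvPolynomial (Fin n) ℂ))
    (hV : V < homogeneousSubmodule (Fin n) ℂ 1) (I : Ideal (MvPolynomial (Fin n) ℂ))
    (hI : I = Ideal.span (V : Set (MvPolynomial (Fin n) ℂ))) :
    NoSoc (mm n) I := by
  obtain ⟨U, hU⟩ := V.exists_isCompl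
  let q : MvPolynomial (Fin n) ℂ →ₗ[ℂ] MvPolynomial (Fin n) ℂ :=
    LinearMap.id - V.subtype ∘ₗ (Submodule.projectionOnto V U hU)
  have hq1 : ∀ v ∈ V, q v = 0 := by
    intro v hv
    have := Submodule.projectionOnto_apply_left hU ⟨v, hv⟩
    simp only at this
    simp [q, this]
  have hq2 : ∀ v, v - q v ∈ V := by
    intro v
    simp [q]
  let π : MvPolynomial (Fin n) ℂ →ₐ[ℂ] MvPolynomial (Fin n) ℂ := aeval (fun i => q (X i))
  have hπ : ∀ v ∈ homogeneousSubmodule (Fin n) ℂ 1, π v = q v := by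
    intro v hv
    rw [homogeneousSubmodule_one_eq_span_X] at hv
    induction hv using Submodule.span_induction with
    | mem x hx => obtain ⟨i, rfl⟩ := hx; simp [π]
    | zero => simp
    | add x y _ _ hx hy => simp [hx, hy]
    | smul c x _ hx => simp [hx]
  have hsub : ∀ u, u - π u ∈ I := by
    intro u
    rw [← Ideal.Quotient.eq]
    have : (Ideal.Quotient.mkₐ ℂ I) = (Ideal.Quotient.mkₐ ℂ I).comp π := by
      apply MvPolynomial.algHom_ext
      intro i
      simp only [AlgHom.comp_apply, Ideal.Quotient.mkₐ_eq_mk]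
      rw [Ideal.Quotient.eq, hπ _ (isHomogeneous_X _ i), hI]
      exact Ideal.subset_span (hq2 _)
    exact congrArg (fun f => f u) this
  have hker : ∀ u, u ∈ I ↔ π u = 0 := by
    intro u
    constructor
    · intro hu
      have : I ≤ RingHom.ker π := by
        rw [hI, Ideal.span_le]
        intro v hv
        rw [SetLike.mem_coe, RingHom.mem_ker, hπ v (hV.le hv), hq1 v hv]
      exact this hu
    · intro hu
      have := hsub u
      rwa [hu, sub_zero] at this
  obtain ⟨x, hx1, hxV⟩ := SetLike.exists_of_lt hV
  intro u hu
  have h := hu x (mem_mm_of_hom (d := 0) hx1)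
  rw [hker, map_mul, mul_eq_zero] at h
  rcases h with h | h
  · exfalso
    apply hxV
    rw [hπ x hx1] at h
    have := hq2 x
    rwa [h, sub_zero] at this
  · exact (hker u).2 h

theorem finrank_S1 : Module.finrank ℂ (homogeneousSubmodule (Fin n) ℂ 1) = n := by
  rw [homogeneousSubmodule_one_eq_span_X, finrank_span_eq_card]
  · simp
  · exact linearIndependent_X _ _

theorem fd_hom (d : ℕ) : FiniteDimensional ℂ (homogeneousSubmodule (Fin n) ℂ d) :=
  Module.Finite.iff_fg.2 (homogeneousSubmodule_fg (σ := Fin n) (R := ℂ) d)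

theorem lid_linear (Z : List (MvPolynomial (Fin n) ℂ)) :
    lid ⊥ Z = Ideal.span (Submodule.span ℂ {g | g ∈ Z} : Set (MvPolynomial (Fin n) ℂ)) := by
  apply le_antisymm
  · exact lid_le _ _ _ bot_le fun g hg => Ideal.subset_span (Submodule.subset_span hg)
  · rw [Ideal.span_le]
    have : Submodule.span ℂ {g | g ∈ Z} ≤ (lid ⊥ Z).restrictScalars ℂ := by
      rw [Submodule.span_le]
      intro g hg
      exact mem_lid _ _ _ hg
    exact this

theorem linear_lt (Z : List (MvPolynomial (Fin n) ℂ)) (hZ : ∀ z ∈ Z, z.IsHomogeneous 1)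
    (hlt : Z.length < n) : NoSoc (mm n) (lid ⊥ Z) := by
  refine linear_prime (Submodule.span ℂ {g | g ∈ Z}) ?_ _ (lid_linear Z)
  refine lt_of_le_of_ne ?_ ?_
  · rw [Submodule.span_le]; exact hZ
  · intro h
    have h2 := finrank_span_finset_le_card (R := ℂ) Z.toFinset
    have h3 : (Z.toFinset : Set (MvPolynomial (Fin n) ℂ)) = {g | g ∈ Z} := by ext; simp
    rw [Set.finrank, h3, h, finrank_S1] at h2
    have := Z.toFinset_card_le
    omega

theorem linear_eq (Z : List (MvPolynomial (Fin n) ℂ)) (hZ : ∀ z ∈ Z, z.IsHomogeneous 1)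
    (hreg : RegSeq ⊥ Z) (hlen : Z.length = n) : lid ⊥ Z = mm n := by
  have hZm : ∀ z ∈ Z, z ∈ mm n := fun z hz => mem_mm_of_hom (d := 0) (hZ z hz)
  apply le_antisymm (lid_le _ _ _ bot_le hZm)
  have := fd_hom (n := n) 1
  obtain ⟨W', h1, h2, h3⟩ := regSeq_rank (mm n) mm_ne_top (homogeneousSubmodule (Fin n) ℂ 1) Z
    hZ hZm hreg
  have : W' = homogeneousSubmodule (Fin n) ℂ 1 := by
    apply Submodule.eq_of_le_of_finrank_le h1
    rw [finrank_S1]; omega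
  unfold mm
  rw [Ideal.span_le]
  rintro _ ⟨i, rfl⟩
  apply h3
  rw [this]
  exact isHomogeneous_X _ i

/-- Regular sequences of linear forms and quadrics of length `j` have no socle. -/
def PP (n j : ℕ) : Prop := ∀ Z l : List (MvPolynomial (Fin n) ℂ), (∀ z ∈ Z, z.IsHomogeneous 1) →
  (∀ z ∈ l, z.IsHomogeneous 2) → RegSeq ⊥ (Z ++ l) → Z.length + l.length = j →
  NoSoc (mm n) (lid ⊥ (Z ++ l))

attribute [local instance] MvPolynomial.gradedAlgebra

theorem lid_hom (I : Ideal (MvPolynomial (Fin n) ℂ))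
    (hI : I.IsHomogeneous (homogeneousSubmodule (Fin n) ℂ)) (l : List (MvPolynomial (Fin n) ℂ))
    (hl : ∀ z ∈ l, ∃ d, z.IsHomogeneous d) :
    (lid I l).IsHomogeneous (homogeneousSubmodule (Fin n) ℂ) := by
  induction l generalizing I with
  | nil => exact hI
  | cons g l ih =>
    refine ih _ (hI.sup (Ideal.homogeneous_span _ _ ?_)) fun z hz => hl z (by simp [hz])
    intro x hx
    rw [Set.mem_singleton_iff.1 hx]
    exact hl g (by simp)

theorem reduce (k : ℕ) (HP : ∀ j < k, PP n j) (C : Ideal (MvPolynomial (Fin n) ℂ) → ℕ → Prop)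
    (base : ∀ Z : List (MvPolynomial (Fin n) ℂ), (∀ z ∈ Z, z.IsHomogeneous 1) →
      RegSeq ⊥ Z → Z.length = k → C (lid ⊥ Z) 0)
    (step : ∀ (I : Ideal (MvPolynomial (Fin n) ℂ)) z g e,
      I.IsHomogeneous (homogeneousSubmodule (Fin n) ℂ) → z.IsHomogeneous 1 → g.IsHomogeneous 2 →
      RegMod I z → RegMod I g → C (I ⊔ Ideal.span {z}) e → C (I ⊔ Ideal.span {g}) (e + 1))
    (l : List (MvPolynomial (Fin n) ℂ)) : ∀ Z : List (MvPolynomial (Fin n) ℂ),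
    (∀ z ∈ Z, z.IsHomogeneous 1) → (∀ z ∈ l, z.IsHomogeneous 2) → RegSeq ⊥ (Z ++ l) →
    Z.length + l.length = k → C (lid ⊥ (Z ++ l)) l.length := by
  induction l using List.reverseRecOn with
  | nil =>
    intro Z hZ _ hr hk
    rw [List.append_nil] at hr ⊢
    exact base Z hZ hr (by simpa using hk)
  | append_singleton l g ih =>
    intro Z hZ hl hr hk
    have hl' : ∀ z ∈ l, z.IsHomogeneous 2 := fun z hz => hl z (by simp [hz])
    rw [regSeq_append, regSeq_append] at hr
    obtain ⟨hr1, hr2, hr3, -⟩ := hr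
    simp only [List.length_append, List.length_singleton] at hk
    have hfin : Finite {p // p ∈ l.inits} := (List.finite_toSet l.inits).to_subtype
    obtain ⟨z, hz1, hz⟩ := exists_regMod (k := ℂ) (mm n) (homogeneousSubmodule (Fin n) ℂ 1)
      (by
        intro P _ hP
        unfold mm
        rw [Ideal.span_le]
        rintro _ ⟨i, rfl⟩
        exact hP _ (isHomogeneous_X _ i))
      (fun p : {p // p ∈ l.inits} => lid ⊥ (Z ++ p.1)) (by
        rintro ⟨p, hp⟩
        have hp' : p <+: l := by simpa using hp
        obtain ⟨s, rfl⟩ := hp'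
        rw [regSeq_append] at hr2
        refine HP (Z.length + p.length) ?_ Z p hZ (fun z hz => hl' z (by simp [hz])) ?_ rfl
        · simp only [List.length_append] at hk; omega
        · rw [regSeq_append]; exact ⟨hr1, hr2.1⟩)
    have hz' : ∀ p, p <+: l → RegMod (lid (lid ⊥ Z) p) z := by
      intro p hp
      rw [← lid_append]
      exact hz ⟨p, by simpa using hp⟩
    have := ih (Z ++ [z]) (by
        intro y hy
        rcases List.mem_append.1 hy with h | h
        · exact hZ y h
        · rw [List.mem_singleton.1 h]; exact hz1) hl' (by
        rw [regSeq_append, regSeq_append, lid_append]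
        refine ⟨⟨hr1, ?_, trivial⟩, ?_⟩
        · exact hz' [] (by simp)
        · exact regSeq_insert _ _ _ hr2 hz') (by simp; omega)
    rw [lid_append, lid_append] at this ⊢
    simp only [lid] at this
    rw [lid_sup] at this
    rw [List.length_append]
    refine step _ z g _ ?_ hz1 (hl g (by simp)) (hz' l (List.prefix_refl l)) hr3 this
    apply lid_hom _ _ _ fun z hz => ⟨2, hl' z hz⟩
    apply lid_hom _ _ _ fun z hz => ⟨1, hZ z hz⟩
    exact Ideal.IsHomogeneous.bot _

theorem PP_all (j : ℕ) (hj : j < n) : PP n j := by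
  induction j using Nat.strong_induction_on with
  | _ j ih =>
    intro Z l hZ hl hr hk
    refine reduce j (fun i hi => ih i hi (hi.trans hj)) (fun I _ => NoSoc (mm n) I) ?_ ?_ l Z hZ hl
      hr hk
    · intro Z hZ _ hk
      exact linear_lt Z hZ (by omega)
    · intro I z g e _ hz hg hzr hgr h
      exact noSoc_swap (mem_mm_of_hom (d := 0) hz) hzr hgr h

/-- The socle of `S/I` is one-dimensional, spanned by a form of degree `e`. -/
def SocD (I : Ideal (MvPolynomial (Fin n) ℂ)) (e : ℕ) : Prop :=
  ∃ w : MvPolynomial (Fin n) ℂ, w.IsHomogeneous e ∧ w ∉ I ∧ (∀ c ∈ mm n, c * w ∈ I) ∧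
    ∀ u, (∀ c ∈ mm n, c * u ∈ I) → ∃ c : ℂ, u - C c * w ∈ I

theorem homComp_mul {z v : MvPolynomial (Fin n) ℂ} {a b : ℕ} (hz : z.IsHomogeneous a) :
    homogeneousComponent (a + b) (z * v) = z * homogeneousComponent b v := by
  have h := DirectSum.coe_decompose_mul_add_of_left_mem (homogeneousSubmodule (Fin n) ℂ)
    (b := v) (j := b) hz
  have e : ∀ (u : MvPolynomial (Fin n) ℂ) (i : ℕ),
      ((DirectSum.decompose (homogeneousSubmodule (Fin n) ℂ) u i :) : MvPolynomial (Fin n) ℂ)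
        = homogeneousComponent i u := fun u i => decomposition.decompose'_apply u i
  rw [e, e] at h
  exact h

theorem socD_swap (I : Ideal (MvPolynomial (Fin n) ℂ)) (z g : MvPolynomial (Fin n) ℂ) (e : ℕ)
    (hI : I.IsHomogeneous (homogeneousSubmodule (Fin n) ℂ)) (hz : z.IsHomogeneous 1)
    (hg : g.IsHomogeneous 2) (hzr : RegMod I z) (hgr : RegMod I g)
    (h : SocD (I ⊔ Ideal.span {z}) e) : SocD (I ⊔ Ideal.span {g}) (e + 1) := by
  obtain ⟨w, hw, hwI, hwm, hwu⟩ := h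
  have hzm : z ∈ mm n := mem_mm_of_hom (d := 0) hz
  have hgm : g ∈ mm n := mem_mm_of_hom (d := 1) hg
  obtain ⟨v0, hv0⟩ := mem_sup_span.1 (hwm g hgm)
  have hv1 := homogeneousComponent_mem_of_mem hI hv0 (1 + (e + 1))
  rw [map_sub, homComp_mul hz] at hv1
  have hgw : homogeneousComponent (1 + (e + 1)) (g * w) = g * w := by
    apply homogeneousComponent_eq_self
    have := hg.mul hw
    convert this using 1; ring
  rw [hgw] at hv1
  set v := homogeneousComponent (e + 1) v0
  refine ⟨v, homogeneousComponent_isHomogeneous _ _, ?_, soc_transfer hzr hwm hv1, ?_⟩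
  · intro hv
    obtain ⟨t, ht⟩ := mem_sup_span.1 hv
    apply hwI
    rw [mem_sup_span]
    refine ⟨t, hgr _ ?_⟩
    have := I.add_mem hv1 (I.mul_mem_left z ht)
    convert this using 1; ring
  · intro u hu
    obtain ⟨u', hu'⟩ := mem_sup_span.1 (hu z hzm)
    obtain ⟨c, hc⟩ := hwu u' (soc_transfer hgr hu hu')
    refine ⟨c, ?_⟩
    obtain ⟨t, ht⟩ := mem_sup_span.1 hc
    rw [mem_sup_span]
    refine ⟨t, hzr _ ?_⟩
    have := I.add_mem (I.add_mem hu' (I.mul_mem_left g ht)) (I.mul_mem_left (C c) hv1)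
    convert this using 1; ring

theorem socD_regular (l : List (MvPolynomial (Fin n) ℂ)) (hl : ∀ z ∈ l, z.IsHomogeneous 2)
    (hr : RegSeq ⊥ l) (hk : l.length = n) : SocD (lid ⊥ l) n := by
  have := reduce n (PP_all (n := n)) SocD ?_ socD_swap l [] (by simp) hl hr (by simpa using hk)
  · rw [hk] at this
    exact this
  · intro Z hZ hr hk
    rw [linear_eq Z hZ hr hk]
    refine ⟨1, isHomogeneous_one _ _, ?_, by simp, ?_⟩
    · rw [← Ideal.ne_top_iff_one]; exact mm_ne_top
    · intro u _
      refine ⟨coeff 0 u, ?_⟩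
      rw [mul_one]
      unfold mm
      rw [← Set.image_univ, mem_ideal_span_X_image]
      intro m hm
      by_contra hcon
      push Not at hcon
      have h0 : m = 0 := by ext i; simpa using hcon i
      rw [mem_support_iff, h0] at hm
      simp at hm

/-- `n` quadrics in `n` variables without a common zero have socle in degree `n`. -/
theorem socD_quadrics (f : Fin n → MvPolynomial (Fin n) ℂ) (hf : ∀ i, (f i).IsHomogeneous 2)
    (hrad : mm n ≤ (Ideal.span (Set.range f)).radical) : SocD (Ideal.span (Set.range f)) n := by
  set W := Submodule.span ℂ (Set.range f) with hWdef
  have hWJ : ∀ w ∈ W, w ∈ Ideal.span (Set.range f) := by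
    have : W ≤ (Ideal.span (Set.range f)).restrictScalars ℂ := by
      rw [hWdef, Submodule.span_le]; exact Ideal.subset_span
    exact this
  have hW2 : ∀ w ∈ W, w.IsHomogeneous 2 := by
    have : W ≤ homogeneousSubmodule (Fin n) ℂ 2 := by
      rw [hWdef, Submodule.span_le]
      rintro _ ⟨i, rfl⟩
      exact hf i
    exact this
  have hfW : ∀ i, f i ∈ W := fun i => Submodule.subset_span ⟨i, rfl⟩
  have key : ∀ k ≤ n, ∃ l : List (MvPolynomial (Fin n) ℂ), l.length = k ∧ (∀ g ∈ l, g ∈ W) ∧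
      RegSeq ⊥ l := by
    intro k
    induction k with
    | zero => exact fun _ => ⟨[], rfl, by simp, trivial⟩
    | succ k ih =>
      intro hk
      obtain ⟨l, h1, h2, h3⟩ := ih (by omega)
      have := PP_all k (by omega) [] l (by simp) (fun z hz => hW2 z (h2 z hz)) h3 (by simpa using h1)
      obtain ⟨w, hwW, hw⟩ := exists_regMod (k := ℂ) (mm n) W (by
        intro P hP hPW
        refine hrad.trans (hP.radical_le_iff.2 ?_)
        rw [Ideal.span_le]
        rintro _ ⟨i, rfl⟩
        exact hPW _ (hfW i)) (fun _ : Unit => lid ⊥ l) (fun _ => this)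
      refine ⟨l ++ [w], by simp [h1], ?_, ?_⟩
      · intro g hg
        rcases List.mem_append.1 hg with h | h
        · exact h2 g h
        · rw [List.mem_singleton.1 h]; exact hwW
      · rw [regSeq_append]
        exact ⟨h3, hw (), trivial⟩
  obtain ⟨l, h1, h2, h3⟩ := key n le_rfl
  have hs := socD_regular l (fun z hz => hW2 z (h2 z hz)) h3 h1
  have hfd : FiniteDimensional ℂ W := FiniteDimensional.span_of_finite ℂ (Set.finite_range f)
  obtain ⟨W', g1, g2, g3⟩ := regSeq_rank (mm n) mm_ne_top W l h2
    (fun z hz => mem_mm_of_hom (d := 1) (hW2 z (h2 z hz))) h3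
  have hWW : W' = W := by
    apply Submodule.eq_of_le_of_finrank_le g1
    have := finrank_range_le_card (R := ℂ) f
    rw [Set.finrank, ← hWdef] at this
    simp at this
    omega
  have : lid ⊥ l = Ideal.span (Set.range f) := by
    apply le_antisymm
    · exact lid_le _ _ _ bot_le fun g hg => hWJ g (h2 g hg)
    · rw [Ideal.span_le]
      rintro _ ⟨i, rfl⟩
      apply g3
      rw [hWW]
      exact hfW i
  rwa [this] at hs

end poly

section dual
attribute [local instance] MvPolynomial.gradedAlgebra

theorem top_degree {n : ℕ} (J : Ideal (MvPolynomial (Fin n) ℂ))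
    (hJ : J.IsHomogeneous (homogeneousSubmodule (Fin n) ℂ)) (e : ℕ) (w : MvPolynomial (Fin n) ℂ)
    (hw : w.IsHomogeneous e)
    (hsoc : ∀ u, (∀ c ∈ mm n, c * u ∈ J) → ∃ c : ℂ, u - C c * w ∈ J) (k : ℕ) :
    ∀ (d : ℕ) (u : MvPolynomial (Fin n) ℂ), u.IsHomogeneous d → (∀ c ∈ (mm n) ^ k, c * u ∈ J) →
      u ∉ J → d ≤ e ∧ ∃ v : MvPolynomial (Fin n) ℂ, v.IsHomogeneous (e - d) ∧ u * v ∉ J := by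
  induction k with
  | zero =>
    intro d u _ h hu
    exact absurd (by simpa using h 1 (by simp)) hu
  | succ k ih =>
    intro d u hud h hu
    by_cases hm : ∀ c ∈ mm n, c * u ∈ J
    · obtain ⟨c, hc⟩ := hsoc u hm
      have hde : d = e := by
        by_contra hne
        apply hu
        have := homogeneousComponent_mem_of_mem hJ hc d
        rw [map_sub, homogeneousComponent_of_mem hud,
          homogeneousComponent_of_mem (hw.C_mul c), if_pos rfl, if_neg hne, sub_zero] at this
        exact this
      subst hde
      exact ⟨le_rfl, 1, by simpa using isHomogeneous_one _ _, by simpa using hu⟩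
    · have : ∃ i, X i * u ∉ J := by
        by_contra hcon
        push Not at hcon
        apply hm
        have : mm n ≤ Submodule.colon J {u} := by
          unfold mm
          rw [Ideal.span_le]
          rintro _ ⟨i, rfl⟩
          rw [SetLike.mem_coe, Submodule.mem_colon_singleton]
          exact hcon i
        intro c hc
        have := this hc
        rwa [Submodule.mem_colon_singleton] at this
      obtain ⟨i, hi⟩ := this
      obtain ⟨h1, v, hv, hv2⟩ := ih (1 + d) (X i * u) ((isHomogeneous_X _ i).mul hud) (by
        intro c hc
        have : c * X i ∈ mm n ^ (k + 1) := by
          rw [pow_succ]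
          exact Ideal.mul_mem_mul hc (Ideal.subset_span ⟨i, rfl⟩)
        have := h _ this
        rwa [mul_assoc] at this) hi
      refine ⟨by omega, X i * v, ?_, ?_⟩
      · have := (isHomogeneous_X ℂ i).mul hv
        convert this using 1; omega
      · convert hv2 using 2; ring

theorem duality (F : MvPolynomial (Fin 5) ℂ) (hF : F.IsHomogeneous 3) (hs : SmoothForm F) :
    ∃ φ : MvPolynomial (Fin 5) ℂ →ₗ[ℂ] ℂ, (∀ u ∈ jacobianIdeal F, φ u = 0) ∧
      (∀ u, u.IsHomogeneous 5 → φ u = 0 → u ∈ jacobianIdeal F) ∧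
      ∀ b, b.IsHomogeneous 3 → (∀ q, q.IsHomogeneous 2 → φ (b * q) = 0) →
        b ∈ jacobianIdeal F := by
  have hf : ∀ i, (pderiv i F).IsHomogeneous 2 := fun i => hF.pderiv
  have hrad : mm 5 ≤ (jacobianIdeal F).radical := by
    rw [← vanishingIdeal_zeroLocus_eq_radical (K := ℂ)]
    unfold mm
    rw [Ideal.span_le]
    rintro _ ⟨i, rfl⟩
    rw [SetLike.mem_coe, mem_vanishingIdeal_iff]
    intro x hx
    have : x = 0 := by
      apply hs
      intro j
      have := hx (pderiv j F) (Ideal.subset_span ⟨j, rfl⟩)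
      simpa [aeval_eq_eval] using this
    simp [this]
  have hJ : (jacobianIdeal F).IsHomogeneous (homogeneousSubmodule (Fin 5) ℂ) := by
    apply Ideal.homogeneous_span
    rintro _ ⟨i, rfl⟩
    exact ⟨2, hf i⟩
  obtain ⟨w, hw, hwJ, hwm, hsoc⟩ := socD_quadrics (fun i => pderiv i F) hf hrad
  change w ∉ jacobianIdeal F at hwJ
  change ∀ c ∈ mm 5, c * w ∈ jacobianIdeal F at hwm
  change ∀ u, (∀ c ∈ mm 5, c * u ∈ jacobianIdeal F) → ∃ c : ℂ, u - C c * w ∈ jacobianIdeal F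
    at hsoc
  generalize jacobianIdeal F = J at *
  obtain ⟨N, hN⟩ := Ideal.exists_radical_pow_le_of_fg J (IsNoetherian.noetherian _)
  have top : ∀ (d : ℕ) (u : MvPolynomial (Fin 5) ℂ), u.IsHomogeneous d → u ∉ J →
      d ≤ 5 ∧ ∃ v : MvPolynomial (Fin 5) ℂ, v.IsHomogeneous (5 - d) ∧ u * v ∉ J := by
    intro d u hu hn
    refine top_degree J hJ 5 w hw hsoc N d u hu ?_ hn
    intro c hc
    exact J.mul_mem_right _ (hN (Ideal.pow_right_mono hrad N hc))
  obtain ⟨ψ, hψ⟩ := Module.exists_dual_forall_apply_ne_zero (K := ℂ)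
    (fun _ : Unit => Ideal.Quotient.mk J w)
    (fun _ => by rwa [Ne, Ideal.Quotient.eq_zero_iff_mem])
  let φ : MvPolynomial (Fin 5) ℂ →ₗ[ℂ] ℂ := ψ ∘ₗ (Ideal.Quotient.mkₐ ℂ J).toLinearMap
  have hφJ : ∀ u ∈ J, φ u = 0 := by
    intro u hu
    simp [φ, Ideal.Quotient.eq_zero_iff_mem.2 hu]
  have hφ5 : ∀ u, u.IsHomogeneous 5 → φ u = 0 → u ∈ J := by
    intro u hu h0
    obtain ⟨c, hc⟩ := hsoc u (by
      have : mm 5 ≤ Submodule.colon J {u} := by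
        unfold mm
        rw [Ideal.span_le]
        rintro _ ⟨i, rfl⟩
        rw [SetLike.mem_coe, Submodule.mem_colon_singleton]
        by_contra hcon
        have := (top (1 + 5) (X i * u) ((isHomogeneous_X _ i).mul hu) hcon).1
        omega
      intro c hc
      have := this hc
      rwa [Submodule.mem_colon_singleton] at this)
    have h1 := hφJ _ hc
    rw [map_sub, h0, C_mul', map_smul, zero_sub, neg_eq_zero, smul_eq_mul, mul_eq_zero] at h1
    rcases h1 with h1 | h1
    · simpa [h1] using hc
    · exact absurd h1 (hψ ())
  refine ⟨φ, hφJ, hφ5, ?_⟩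
  intro b hb h
  by_contra hbJ
  obtain ⟨-, v, hv, hbv⟩ := top 3 b hb hbJ
  exact hbv (hφ5 _ (hb.mul hv) (h v hv))

end dual

section polar

/-- `m! = ∏ mᵢ!`. -/
noncomputable def wt (m : Fin 5 →₀ ℕ) : ℂ := ∏ i, ((m i).factorial : ℂ)

theorem wt_ne_zero (m : Fin 5 →₀ ℕ) : wt m ≠ 0 := by
  unfold wt
  rw [Finset.prod_ne_zero_iff]
  intro i _
  exact_mod_cast Nat.factorial_ne_zero _

theorem coeff_pderiv_pow (i : Fin 5) (a : ℕ) : ∀ (k : Fin 5 →₀ ℕ) (P : MvPolynomial (Fin 5) ℂ),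
    coeff k ((((pderiv i).toLinearMap : Module.End ℂ (MvPolynomial (Fin 5) ℂ)) ^ a) P) =
      ((k i + 1).ascFactorial a : ℂ) * coeff (k + Finsupp.single i a) P := by
  induction a with
  | zero => intro k P; simp
  | succ a ih =>
    intro k P
    rw [pow_succ, Module.End.mul_apply, ih, Nat.ascFactorial_succ]
    change _ * coeff _ (pderiv i P) = _
    rw [coeff_pderiv, add_assoc, ← Finsupp.single_add]
    simp
    ring

theorem coeff_pderiv_pow' (i : Fin 5) (a : ℕ) (k : Fin 5 →₀ ℕ) (hk : k i = 0)
    (P : MvPolynomial (Fin 5) ℂ) :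
    coeff k ((((pderiv i).toLinearMap : Module.End ℂ (MvPolynomial (Fin 5) ℂ)) ^ a) P) =
      (a.factorial : ℂ) * coeff (k + Finsupp.single i a) P := by
  rw [coeff_pderiv_pow, hk, zero_add, Nat.one_ascFactorial]

theorem polar_monomial (m : Fin 5 →₀ ℕ) (P : MvPolynomial (Fin 5) ℂ) :
    constantCoeff ((List.ofFn fun i : Fin 5 =>
      ((pderiv i).toLinearMap : Module.End ℂ (MvPolynomial (Fin 5) ℂ)) ^ (m i)).prod P) =
      wt m * coeff m P := by
  simp only [List.ofFn_succ, List.ofFn_zero, List.prod_cons, List.prod_nil, mul_one,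
    Module.End.mul_apply, constantCoeff_eq]
  rw [coeff_pderiv_pow' _ _ _ (by simp), coeff_pderiv_pow' _ _ _ (by simp [Finsupp.single_apply]),
    coeff_pderiv_pow' _ _ _ (by simp [Finsupp.single_apply]; try decide),
    coeff_pderiv_pow' _ _ _ (by simp [Finsupp.single_apply]; try decide),
    coeff_pderiv_pow' _ _ _ (by simp [Finsupp.single_apply]; try decide)]
  have hm : (0 + Finsupp.single 0 (m 0) + Finsupp.single (Fin.succ 0) (m (Fin.succ 0)) +
      Finsupp.single (Fin.succ (Fin.succ 0)) (m (Fin.succ (Fin.succ 0))) +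
      Finsupp.single (Fin.succ (Fin.succ (Fin.succ 0))) (m (Fin.succ (Fin.succ (Fin.succ 0)))) +
      Finsupp.single (Fin.succ (Fin.succ (Fin.succ (Fin.succ 0))))
        (m (Fin.succ (Fin.succ (Fin.succ (Fin.succ 0))))) : Fin 5 →₀ ℕ) = m := by
    ext j
    fin_cases j <;> simp [Finsupp.single_apply]
  rw [hm]
  simp only [wt, Fin.prod_univ_five]
  change ((m 0).factorial : ℂ) * ((m 1).factorial * ((m 2).factorial *
    ((m 3).factorial * ((m 4).factorial * coeff m P)))) = _
  ring

/-- The monomials of degree three. -/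
noncomputable def T3 : Finset (Fin 5 →₀ ℕ) := Finset.univ.finsuppAntidiag 3

theorem mem_T3 (m : Fin 5 →₀ ℕ) : m ∈ T3 ↔ m.degree = 3 := by
  simp [T3, Finset.mem_finsuppAntidiag, Finsupp.degree_eq_sum]

theorem support_T3 {G : MvPolynomial (Fin 5) ℂ} (hG : G.IsHomogeneous 3) : G.support ⊆ T3 := by
  intro m hm
  rw [mem_T3]
  by_contra h
  exact mem_support_iff.1 hm (hG.coeff_eq_zero h)

theorem polarPair_eq (b G : MvPolynomial (Fin 5) ℂ) (hG : G.IsHomogeneous 3) :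
    polarPair b G = ∑ m ∈ T3, coeff m G * (wt m * coeff m b) := by
  unfold polarPair
  rw [map_sum, ← Finset.sum_subset (support_T3 hG)]
  · refine Finset.sum_congr rfl fun m _ => ?_
    rw [constantCoeff_smul, polar_monomial, smul_eq_mul]
  · intro m _ hm
    rw [notMem_support_iff.1 hm, zero_mul]

/-- The cubic associated with `Q` by the functional `φ`. -/
noncomputable def assocCubic (φ : MvPolynomial (Fin 5) ℂ →ₗ[ℂ] ℂ) :
    MvPolynomial (Fin 5) ℂ →ₗ[ℂ] MvPolynomial (Fin 5) ℂ :=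
  ∑ m ∈ T3, (monomial m : ℂ →ₗ[ℂ] MvPolynomial (Fin 5) ℂ) ∘ₗ
    ((wt m)⁻¹ • (φ ∘ₗ LinearMap.mulLeft ℂ (monomial m 1)))

theorem assocCubic_apply (φ : MvPolynomial (Fin 5) ℂ →ₗ[ℂ] ℂ) (Q : MvPolynomial (Fin 5) ℂ) :
    assocCubic φ Q = ∑ m ∈ T3, monomial m ((wt m)⁻¹ * φ (monomial m 1 * Q)) := by
  simp [assocCubic]

theorem assocCubic_hom (φ : MvPolynomial (Fin 5) ℂ →ₗ[ℂ] ℂ) (Q : MvPolynomial (Fin 5) ℂ) :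
    (assocCubic φ Q).IsHomogeneous 3 := by
  rw [assocCubic_apply]
  exact IsHomogeneous.sum _ _ _ fun m hm => isHomogeneous_monomial _ ((mem_T3 m).1 hm)

theorem assocCubic_coeff (φ : MvPolynomial (Fin 5) ℂ →ₗ[ℂ] ℂ) (Q : MvPolynomial (Fin 5) ℂ)
    (m : Fin 5 →₀ ℕ) (hm : m ∈ T3) :
    coeff m (assocCubic φ Q) = (wt m)⁻¹ * φ (monomial m 1 * Q) := by
  rw [assocCubic_apply, coeff_sum]
  simp [coeff_monomial, hm]

theorem expand3 (b : MvPolynomial (Fin 5) ℂ) (hb : b.IsHomogeneous 3) :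
    b = ∑ m ∈ T3, coeff m b • monomial m (1 : ℂ) := by
  conv_lhs => rw [as_sum b]
  rw [Finset.sum_subset (support_T3 hb)]
  · simp [smul_monomial]
  · intro m _ hm
    rw [notMem_support_iff.1 hm, monomial_zero]

theorem polar_assoc (φ : MvPolynomial (Fin 5) ℂ →ₗ[ℂ] ℂ) (Q b : MvPolynomial (Fin 5) ℂ)
    (hb : b.IsHomogeneous 3) : polarPair b (assocCubic φ Q) = φ (b * Q) := by
  rw [polarPair_eq _ _ (assocCubic_hom φ Q)]
  conv_rhs => rw [expand3 b hb]
  rw [Finset.sum_mul, map_sum]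
  refine Finset.sum_congr rfl fun m hm => ?_
  rw [assocCubic_coeff φ Q m hm, smul_mul_assoc, map_smul, smul_eq_mul]
  have := wt_ne_zero m
  field_simp

theorem polarPair_monomial (m : Fin 5 →₀ ℕ) (hm : m ∈ T3) (G : MvPolynomial (Fin 5) ℂ)
    (hG : G.IsHomogeneous 3) : polarPair (monomial m 1) G = coeff m G * wt m := by
  rw [polarPair_eq _ _ hG]
  simp [coeff_monomial, hm]

/-- The polar pairing with a fixed cubic as a functional. -/
noncomputable def pairR (G : MvPolynomial (Fin 5) ℂ) : MvPolynomial (Fin 5) ℂ →ₗ[ℂ] ℂ :=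
  ∑ m ∈ T3, (coeff m G * wt m) • (lcoeff ℂ m)

theorem pairR_apply (G : MvPolynomial (Fin 5) ℂ) (hG : G.IsHomogeneous 3)
    (b : MvPolynomial (Fin 5) ℂ) : pairR G b = polarPair b G := by
  rw [polarPair_eq _ _ hG]
  simp [pairR, mul_assoc]

theorem ext_polar {G G' : MvPolynomial (Fin 5) ℂ} (hG : G.IsHomogeneous 3)
    (hG' : G'.IsHomogeneous 3)
    (h : ∀ b : MvPolynomial (Fin 5) ℂ, b.IsHomogeneous 3 → polarPair b G = polarPair b G') :
    G = G' := by
  ext m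
  by_cases hm : m ∈ T3
  · have := h (monomial m 1) (isHomogeneous_monomial _ ((mem_T3 m).1 hm))
    rw [polarPair_monomial m hm G hG, polarPair_monomial m hm G' hG'] at this
    exact mul_right_cancel₀ (wt_ne_zero m) this
  · rw [mem_T3] at hm
    rw [hG.coeff_eq_zero hm, hG'.coeff_eq_zero hm]

theorem perp_colon (F Q : MvPolynomial (Fin 5) ℂ) (hQ : Q.IsHomogeneous 2)
    (φ : MvPolynomial (Fin 5) ℂ →ₗ[ℂ] ℂ) (h1 : ∀ u ∈ jacobianIdeal F, φ u = 0)
    (h2 : ∀ u, u.IsHomogeneous 5 → φ u = 0 → u ∈ jacobianIdeal F) (hne : assocCubic φ Q ≠ 0) :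
    perp (colonFive F Q) = Set.range (fun c : ℂ => c • assocCubic φ Q) := by
  have hsm : ∀ c : ℂ, (c • assocCubic φ Q).IsHomogeneous 3 := fun c =>
    (homogeneousSubmodule (Fin 5) ℂ 3).smul_mem c (assocCubic_hom φ Q)
  have hps : ∀ (c : ℂ) (b : MvPolynomial (Fin 5) ℂ), b.IsHomogeneous 3 →
      polarPair b (c • assocCubic φ Q) = c * φ (b * Q) := by
    intro c b hb
    rw [← map_smul, polar_assoc φ _ b hb, mul_smul_comm, map_smul, smul_eq_mul]
  ext G
  constructor
  · rintro ⟨hG, hG0⟩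
    have hb0 : ∃ b : MvPolynomial (Fin 5) ℂ, b.IsHomogeneous 3 ∧ φ (b * Q) ≠ 0 := by
      by_contra hcon
      push Not at hcon
      apply hne
      apply ext_polar (assocCubic_hom φ Q) (isHomogeneous_zero _ _ _)
      intro b hb
      rw [polar_assoc φ Q b hb, hcon b hb, polarPair_eq _ _ (isHomogeneous_zero _ _ _)]
      simp
    obtain ⟨b0, hb0, hb1⟩ := hb0
    refine ⟨(φ (b0 * Q))⁻¹ * polarPair b0 G, ?_⟩
    apply ext_polar (hsm _) hG
    intro b hb
    rw [hps _ b hb]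
    have hd : (b - (φ (b * Q) / φ (b0 * Q)) • b0).IsHomogeneous 3 :=
      hb.sub ((homogeneousSubmodule (Fin 5) ℂ 3).smul_mem _ hb0)
    have := hG0 (b - (φ (b * Q) / φ (b0 * Q)) • b0) ⟨hd, h2 _ (hd.mul hQ) (by
      rw [sub_mul, map_sub, smul_mul_assoc, map_smul, smul_eq_mul]
      field_simp
      ring), hd.mul hQ⟩
    rw [← pairR_apply G hG, map_sub, map_smul, sub_eq_zero, smul_eq_mul] at this
    rw [← pairR_apply G hG, ← pairR_apply G hG, this]
    field_simp
  · rintro ⟨c, rfl⟩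
    refine ⟨hsm c, ?_⟩
    rintro b ⟨hb, hbQ, -⟩
    rw [hps c b hb, h1 _ hbQ, mul_zero]

theorem exists_Q0 (F G : MvPolynomial (Fin 5) ℂ)
    (φ : MvPolynomial (Fin 5) ℂ →ₗ[ℂ] ℂ)
    (h3 : ∀ b, b.IsHomogeneous 3 → (∀ q, q.IsHomogeneous 2 → φ (b * q) = 0) →
        b ∈ jacobianIdeal F) (hG : G ∈ perp (Jpart F 3)) :
    ∃ Q : MvPolynomial (Fin 5) ℂ, Q.IsHomogeneous 2 ∧ assocCubic φ Q = G := by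
  have := fd_hom (n := 5) 3
  have := fd_hom (n := 5) 2
  let B : homogeneousSubmodule (Fin 5) ℂ 2 →ₗ[ℂ]
      Module.Dual ℂ (homogeneousSubmodule (Fin 5) ℂ 3) :=
    LinearMap.mk₂ ℂ (fun q b => φ (b.1 * q.1))
      (by intros; simp [mul_add]) (by intros; simp)
      (by intros; simp [add_mul]) (by intros; simp)
  have hmem : (pairR G) ∘ₗ (homogeneousSubmodule (Fin 5) ℂ 3).subtype ∈ LinearMap.range B := by
    rw [← Subspace.dualCoannihilator_dualAnnihilator_eq (W := LinearMap.range B),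
      Submodule.mem_dualAnnihilator]
    intro b hb
    rw [Submodule.mem_dualCoannihilator] at hb
    change pairR G b.1 = 0
    rw [pairR_apply G hG.1]
    apply hG.2
    refine ⟨h3 _ b.2 ?_, b.2⟩
    intro q hq
    exact hb _ ⟨⟨q, hq⟩, rfl⟩
  obtain ⟨Q, hQ⟩ := hmem
  refine ⟨Q.1, Q.2, ext_polar (assocCubic_hom φ _) hG.1 ?_⟩
  intro b hb
  rw [polar_assoc φ _ b hb, ← pairR_apply G hG.1]
  exact congrArg (fun f => f ⟨b, hb⟩) hQ

end polar

/-! ### Genericity of the quadric -/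

section Genericity

open MeasureTheory Filter Topology

/-- A Haar measure on the space of matrices. -/
noncomputable abbrev haarE : Measure (Fin 5 → Fin 5 → ℂ) := Measure.addHaar

theorem differentiable_eval_comp {E : Type*} [NormedAddCommGroup E] [NormedSpace ℝ E]
    (P : MvPolynomial (Fin 5) ℂ) (f : E → Fin 5 → ℂ) (hf : ∀ k, Differentiable ℝ fun M => f M k) :
    Differentiable ℝ fun M => eval (f M) P := by
  induction P using MvPolynomial.induction_on with
  | C a => simp
  | add p q hp hq => simp only [map_add]; exact hp.fun_add hq
  | mul_X p k hp => simp only [map_mul, eval_X]; exact hp.fun_mul (hf k)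

/-- The restriction of a polynomial to an affine line. -/
noncomputable def lineP (F : MvPolynomial (Fin 5) ℂ) (y w : Fin 5 → ℂ) : Polynomial ℂ :=
  aeval (fun k => Polynomial.C (y k) + Polynomial.X * Polynomial.C (w k)) F

theorem lineP_eval (F : MvPolynomial (Fin 5) ℂ) (y w : Fin 5 → ℂ) (t : ℂ) :
    (lineP F y w).eval t = eval (y + t • w) F := by
  induction F using MvPolynomial.induction_on with
  | C a => simp [lineP, Polynomial.algebraMap_eq]
  | add p q hp hq => simp only [lineP, map_add, Polynomial.eval_add] at *; rw [hp, hq]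
  | mul_X p k hp => simp only [lineP, map_mul, Polynomial.eval_mul] at *; rw [hp]; simp [mul_comm (w k)]

theorem eval_smul_hom {F : MvPolynomial (Fin 5) ℂ} {d : ℕ} (hF : F.IsHomogeneous d)
    (s : ℂ) (p : Fin 5 → ℂ) : eval (s • p) F = s ^ d * eval p F := by
  rw [eval_eq, eval_eq, Finset.mul_sum]
  refine Finset.sum_congr rfl fun m hm => ?_
  have h1 : ∑ i ∈ m.support, m i = d := by
    by_contra h0; exact mem_support_iff.1 hm (hF.coeff_eq_zero (by rwa [Finsupp.degree_apply]))
  simp only [Pi.smul_apply, smul_eq_mul, mul_pow, Finset.prod_mul_distrib, Finset.prod_pow_eq_pow_sum,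
    h1]
  ring

theorem lineP_ne_zero {F : MvPolynomial (Fin 5) ℂ} {d : ℕ} (hF : F.IsHomogeneous d)
    (y w : Fin 5 → ℂ) (hw : eval w F ≠ 0) : lineP F y w ≠ 0 := by
  intro h
  have h1 : ∀ s : ℂ, s ≠ 0 → (lineP F w y).eval s = 0 := by
    intro s hs
    have h2 := lineP_eval F y w s⁻¹
    rw [h, Polynomial.eval_zero] at h2
    rw [lineP_eval]
    have h3 : w + s • y = s • (y + s⁻¹ • w) := by
      rw [smul_add, smul_smul, mul_inv_cancel₀ hs, one_smul, add_comm]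
    rw [h3, eval_smul_hom hF, ← h2, mul_zero]
  have h4 : lineP F w y = 0 := by
    refine Polynomial.eq_zero_of_infinite_isRoot _ ?_
    refine Set.Infinite.mono (s := {0}ᶜ) (fun s hs => h1 s hs) ?_
    exact (Set.finite_singleton (0 : ℂ)).infinite_compl
  apply hw
  have h5 := lineP_eval F w y 0
  rw [h4] at h5
  simpa using h5.symm

theorem null_cone {F : MvPolynomial (Fin 5) ℂ} {d : ℕ} (hF : F.IsHomogeneous d)
    (hne : F ≠ 0) (i : Fin 5) :
    haarE {M : Fin 5 → Fin 5 → ℂ | eval (M i) F = 0} = 0 := by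
  obtain ⟨w, hw⟩ : ∃ w : Fin 5 → ℂ, eval w F ≠ 0 := by
    by_contra! h
    exact hne (MvPolynomial.funext fun x => by simpa using h x)
  have hc : Continuous fun M : Fin 5 → Fin 5 → ℂ => eval (M i) F :=
    (differentiable_eval_comp F (fun M : Fin 5 → Fin 5 → ℂ => M i)
      (fun k => by fun_prop)).continuous
  have hm : MeasurableSet {M : Fin 5 → Fin 5 → ℂ | eval (M i) F ≠ 0} :=
    (isOpen_ne_fun hc continuous_const).measurableSet
  let L : ℂ →ₗ[ℝ] (Fin 5 → Fin 5 → ℂ) :=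
    LinearMap.toSpanSingleton ℂ (Fin 5 → Fin 5 → ℂ) (Pi.single i w) |>.restrictScalars ℝ
  have key := ae_mem_of_ae_add_linearMap_mem L (volume : Measure ℂ)
    haarE hm ?_
  · rw [ae_iff] at key
    simpa using key
  · intro y
    rw [ae_iff]
    refine Set.Finite.measure_zero (((lineP F (y i) w).roots.toFinset.finite_toSet).subset ?_) _
    intro t ht
    simp only [Set.mem_setOf_eq, not_not, L] at ht
    simp only [Finset.mem_coe, Multiset.mem_toFinset]
    rw [Polynomial.mem_roots (lineP_ne_zero hF _ _ hw), Polynomial.IsRoot, lineP_eval]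
    simpa using ht

/-- The deformed quadric. -/
noncomputable def QN (Q0 : MvPolynomial (Fin 5) ℂ) (N : Fin 5 → Fin 5 → ℂ) :
    MvPolynomial (Fin 5) ℂ :=
  Q0 + ∑ a, ∑ b, N a b • (X a * X b)

theorem QN_hom {Q0 : MvPolynomial (Fin 5) ℂ} (h : Q0.IsHomogeneous 2) (N : Fin 5 → Fin 5 → ℂ) :
    (QN Q0 N).IsHomogeneous 2 := by
  refine h.add (IsHomogeneous.sum _ _ _ fun a _ => IsHomogeneous.sum _ _ _ fun b _ => ?_)
  rw [smul_eq_C_mul]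
  simpa using (isHomogeneous_C (Fin 5) (N a b)).mul
    ((isHomogeneous_X ℂ a).mul (isHomogeneous_X ℂ b))

theorem QN_eval (Q0 : MvPolynomial (Fin 5) ℂ) (N : Fin 5 → Fin 5 → ℂ) (p : Fin 5 → ℂ) :
    eval p (QN Q0 N) = eval p Q0 + ∑ a, ∑ b, N a b * (p a * p b) := by
  simp [QN, map_sum, smul_eval]

theorem QN_grad (Q0 : MvPolynomial (Fin 5) ℂ) (N : Fin 5 → Fin 5 → ℂ) (p : Fin 5 → ℂ)
    (k : Fin 5) :
    eval p (pderiv k (QN Q0 N)) = eval p (pderiv k Q0) +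
      ∑ a, ∑ b, N a b * ((if b = k then p a else 0) + (if a = k then p b else 0)) := by
  simp only [QN, map_add, map_sum, map_smul, smul_eval, Derivation.leibniz, pderiv_X, smul_eq_mul,
    eval_X, Pi.single_apply, map_mul]
  congr 1
  refine Finset.sum_congr rfl fun a _ => Finset.sum_congr rfl fun b _ => ?_
  split_ifs <;> simp_all <;> ring

/-- The matrix with a row removed. -/
noncomputable def delRow (i : Fin 5) (M : Fin 5 → Fin 5 → ℂ) : Fin 5 → Fin 5 → ℂ :=
  fun a b => if a = i then 0 else M a b

/-- The parametrisation of the bad matrices. -/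
noncomputable def theta (F Q0 : MvPolynomial (Fin 5) ℂ) (i : Fin 5) (μ : ℂ)
    (M : Fin 5 → Fin 5 → ℂ) : Fin 5 → Fin 5 → ℂ :=
  fun a b => if a = i then
    (M i i)⁻¹ * (μ * eval (M i) (pderiv b F) - eval (M i) (pderiv b (QN Q0 (delRow i M)))
      + (if b = i then (M i i)⁻¹ * eval (M i) (QN Q0 (delRow i M)) else 0))
    else M a b

theorem theta_diff (F Q0 : MvPolynomial (Fin 5) ℂ) (i : Fin 5) (μ : ℂ) :
    DifferentiableOn ℝ (theta F Q0 i μ) {M | M i i ≠ 0} := by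
  have hE : ∀ P : MvPolynomial (Fin 5) ℂ,
      Differentiable ℝ fun M : Fin 5 → Fin 5 → ℂ => eval (M i) P :=
    fun P => differentiable_eval_comp P (fun M : Fin 5 → Fin 5 → ℂ => M i) (fun k => by fun_prop)
  have hD : ∀ a b, Differentiable ℝ fun M : Fin 5 → Fin 5 → ℂ => delRow i M a b := by
    intro a b
    unfold delRow
    split_ifs <;> fun_prop
  have hI : DifferentiableOn ℝ (fun M : Fin 5 → Fin 5 → ℂ => (M i i)⁻¹) {M | M i i ≠ 0} := by
    have h0 : Differentiable ℝ (fun M : Fin 5 → Fin 5 → ℂ => M i i) := by fun_prop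
    exact h0.differentiableOn.fun_inv (fun M hM => hM)
  have hQ : Differentiable ℝ fun M : Fin 5 → Fin 5 → ℂ => eval (M i) (QN Q0 (delRow i M)) := by
    simp only [QN_eval]
    have := hE Q0
    fun_prop
  have hG : ∀ k, Differentiable ℝ fun M : Fin 5 → Fin 5 → ℂ =>
      eval (M i) (pderiv k (QN Q0 (delRow i M))) := by
    intro k
    simp only [QN_grad]
    refine (hE _).add ?_
    refine Differentiable.fun_sum fun a _ => Differentiable.fun_sum fun b _ => ?_
    refine (hD a b).mul ?_
    split_ifs <;> fun_prop
  rw [differentiableOn_pi]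
  intro a
  rw [differentiableOn_pi]
  intro b
  unfold theta
  by_cases ha : a = i
  · simp only [ha, if_true]
    refine hI.mul (((((hE _).const_mul μ).sub (hG b)).differentiableOn).add ?_)
    by_cases hb : b = i
    · simp only [hb, if_true]
      exact hI.mul hQ.differentiableOn
    · simp only [hb, if_false]
      fun_prop
  · simp only [ha, if_false]
    fun_prop

theorem theta_eq (F Q0 : MvPolynomial (Fin 5) ℂ) (i : Fin 5) (μ : ℂ)
    (N : Fin 5 → Fin 5 → ℂ) (p : Fin 5 → ℂ) (hp : p i ≠ 0) (hQ : eval p (QN Q0 N) = 0)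
    (hG : ∀ k, eval p (pderiv k (QN Q0 N)) = μ * eval p (pderiv k F)) :
    theta F Q0 i μ (Function.update N i p) = N := by
  have hdel : delRow i (Function.update N i p) = delRow i N := by
    funext a b
    unfold delRow
    split_ifs with h
    · rfl
    · rw [Function.update_of_ne h]
  have hsplit : ∀ f : Fin 5 → Fin 5 → ℂ,
      ∑ a, ∑ b, N a b * f a b = ∑ a, ∑ b, delRow i N a b * f a b + ∑ b, N i b * f i b := by
    intro f
    have h1 : ∑ b, N i b * f i b = ∑ a, if a = i then ∑ b, N a b * f a b else 0 := by simp
    rw [h1, ← Finset.sum_add_distrib]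
    refine Finset.sum_congr rfl fun a _ => ?_
    by_cases h : a = i <;> simp [delRow, h]
  funext a b
  unfold theta
  by_cases ha : a = i
  · subst ha
    rw [if_pos rfl, hdel, Function.update_self, ← hG b]
    rw [QN_eval, hsplit] at hQ
    rw [QN_grad, QN_grad, QN_eval, hsplit]
    set c := ∑ k, N a k * p k with hc
    have e1 : ∑ k, N a k * (p a * p k) = p a * c := by
      rw [hc, Finset.mul_sum]
      exact Finset.sum_congr rfl fun k _ => by ring
    have e2 : ∑ k, N a k * ((if k = b then p a else 0) + (if a = b then p k else 0)) =
        N a b * p a + (if a = b then c else 0) := by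
      simp only [mul_add, Finset.sum_add_distrib]
      congr 1
      · simp
      · split_ifs <;> simp [hc]
    rw [e1] at hQ
    rw [e2]
    have e3 : eval p Q0 + ∑ x, ∑ y, delRow a N x y * (p x * p y) = - (p a * c) := by
      linear_combination hQ
    rw [e3]
    by_cases hb : b = a
    · subst hb
      simp only [if_true]
      field_simp
      ring
    · rw [if_neg hb, if_neg (Ne.symm hb)]
      field_simp
      ring
  · rw [if_neg ha, Function.update_of_ne ha]

theorem smooth_ne_zero {F : MvPolynomial (Fin 5) ℂ} (h : SmoothForm F) : F ≠ 0 := by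
  rintro rfl
  have := h 1 (by simp)
  exact one_ne_zero this

theorem ae_smoothCI {F Q0 : MvPolynomial (Fin 5) ℂ} (hF : F.IsHomogeneous 3) (hs : SmoothForm F)
    (hQ0 : Q0.IsHomogeneous 2) :
    ∀ᵐ N : Fin 5 → Fin 5 → ℂ ∂haarE, SmoothCI F (QN Q0 N) := by
  let bad : Fin 5 → ℂ → Set (Fin 5 → Fin 5 → ℂ) := fun i μ =>
    theta F Q0 i μ '' ({M | M i i ≠ 0} ∩ {M | eval (M i) F = 0})
  have hbad : ∀ i μ, haarE (bad i μ) = 0 := by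
    intro i μ
    refine addHaar_image_eq_zero_of_differentiableOn_of_addHaar_eq_zero haarE
      ((theta_diff F Q0 i μ).mono Set.inter_subset_left) ?_
    exact measure_mono_null Set.inter_subset_right (null_cone hF (smooth_ne_zero hs) i)
  have hall : ∀ᵐ N : Fin 5 → Fin 5 → ℂ ∂haarE, ∀ i, N ∉ bad i 0 ∧ N ∉ bad i 1 := by
    rw [ae_all_iff]
    intro i
    exact (measure_eq_zero_iff_ae_notMem.1 (hbad i 0)).and
      (measure_eq_zero_iff_ae_notMem.1 (hbad i 1))
  filter_upwards [hall] with N hN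
  have hk : ∀ (μ : ℂ), (∀ i, N ∉ bad i μ) → ∀ p : Fin 5 → ℂ, p ≠ 0 → eval p F = 0 →
      eval p (QN Q0 N) = 0 →
      ¬ ∀ k, eval p (pderiv k (QN Q0 N)) = μ * eval p (pderiv k F) := by
    intro μ hμ p hp hpF hpQ hpG
    obtain ⟨i, hi⟩ := Function.ne_iff.1 hp
    refine hμ i ⟨Function.update N i p, ⟨?_, ?_⟩, theta_eq F Q0 i μ N p hi hpQ hpG⟩
    · simpa using hi
    · simpa using hpF
  intro p hp hpF hpQ
  rw [LinearIndependent.pair_iff]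
  intro s t hst
  have hst' : ∀ k, s * eval p (pderiv k F) + t * eval p (pderiv k (QN Q0 N)) = 0 := by
    intro k
    simpa using congrFun hst k
  have ht : t = 0 := by
    by_contra ht
    have hl : ∀ k, eval p (pderiv k (QN Q0 N)) = (-s / t) * eval p (pderiv k F) := by
      intro k
      field_simp
      linear_combination hst' k
    by_cases hs0 : -s / t = 0
    · rw [hs0] at hl
      exact hk 0 (fun i => (hN i).1) p hp hpF hpQ hl
    · refine hk 1 (fun i => (hN i).2) ((-s / t) • p) (smul_ne_zero hs0 hp) ?_ ?_ ?_
      · rw [eval_smul_hom hF, hpF, mul_zero]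
      · rw [eval_smul_hom (QN_hom hQ0 N), hpQ, mul_zero]
      · intro k
        rw [eval_smul_hom (QN_hom hQ0 N).pderiv, eval_smul_hom hF.pderiv, hl k]
        ring
  refine ⟨?_, ht⟩
  by_contra hs1
  refine hp (hs p fun k => ?_)
  have := hst' k
  rw [ht, zero_mul, add_zero] at this
  exact (mul_eq_zero.1 this).resolve_left hs1

theorem open_smooth {G : MvPolynomial (Fin 5) ℂ} (H : Fin 5 → Fin 5 → MvPolynomial (Fin 5) ℂ)
    (hG : G.IsHomogeneous 3) (hH : ∀ a b, (H a b).IsHomogeneous 3) (hs : SmoothForm G) :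
    ∀ᶠ N : Fin 5 → Fin 5 → ℂ in 𝓝 0, SmoothForm (G + ∑ a, ∑ b, N a b • H a b) := by
  have hhom : ∀ N : Fin 5 → Fin 5 → ℂ, (G + ∑ a, ∑ b, N a b • H a b).IsHomogeneous 3 := by
    intro N
    refine hG.add (IsHomogeneous.sum _ _ _ fun a _ => IsHomogeneous.sum _ _ _ fun b _ => ?_)
    rw [smul_eq_C_mul]
    simpa using (isHomogeneous_C (Fin 5) (N a b)).mul (hH a b)
  have hcont : ∀ k, Continuous fun z : (Fin 5 → Fin 5 → ℂ) × (Fin 5 → ℂ) =>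
      eval z.2 (pderiv k (G + ∑ a, ∑ b, z.1 a b • H a b)) := by
    intro k
    have hE : ∀ P : MvPolynomial (Fin 5) ℂ,
        Continuous fun z : (Fin 5 → Fin 5 → ℂ) × (Fin 5 → ℂ) => eval z.2 P := fun P =>
      (MvPolynomial.continuous_eval P).comp continuous_snd
    simp only [map_add, map_sum, map_smul, smul_eval]
    have h1 := hE (pderiv k G)
    have h2 := fun a b => hE (pderiv k (H a b))
    refine h1.add (continuous_finsetSum _ fun a _ => continuous_finsetSum _ fun b _ => ?_)
    have h5 : Continuous fun z : (Fin 5 → Fin 5 → ℂ) × (Fin 5 → ℂ) => z.1 a b :=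
      continuous_fst.matrix_elem a b
    refine (h5.mul (h2 a b)).congr fun z => ?_
    simp [smul_eval]
  have key : ∀ᶠ N : Fin 5 → Fin 5 → ℂ in 𝓝 0, ∀ p ∈ Metric.sphere (0 : Fin 5 → ℂ) 1,
      ∃ k, eval p (pderiv k (G + ∑ a, ∑ b, N a b • H a b)) ≠ 0 := by
    refine (isCompact_sphere (0 : Fin 5 → ℂ) 1).eventually_forall_of_forall_eventually ?_
    intro p hp
    have hp0 : p ≠ 0 := by
      rintro rfl
      simp at hp
    obtain ⟨k, hk⟩ : ∃ k, eval p (pderiv k G) ≠ 0 := by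
      by_contra! h
      exact hp0 (hs p h)
    have h3 := (hcont k).continuousAt (x := ((0 : Fin 5 → Fin 5 → ℂ), p))
    have h4 := h3.eventually_ne (y := 0) (by simpa using hk)
    filter_upwards [h4] with z hz
    exact ⟨k, hz⟩
  filter_upwards [key] with N hN p hp
  by_contra hp0
  have hn : ‖p‖ ≠ 0 := norm_ne_zero_iff.2 hp0
  obtain ⟨k, hk⟩ := hN (((‖p‖ : ℝ) : ℂ)⁻¹ • p) (by simp [norm_smul, hn])
  rw [eval_smul_hom (hhom N).pderiv, hp k, mul_zero] at hk
  exact hk rfl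

end Genericity

/-- For every `F ∈ 𝒰` there is a quadric `Q` with `(F,Q)` a smooth complete intersection
and `(J_{F,5}:Q)^⊥` one-dimensional, spanned by a smooth cubic. -/
theorem exists_Q_smooth_associated_cubic :
    ∀ F ∈ calU, ∃ Q ∈ homogeneousSubmodule (Fin 5) ℂ 2,
      SmoothCI F Q ∧
        ∃ G : MvPolynomial (Fin 5) ℂ, SmoothForm G ∧ G ≠ 0 ∧
          perp (colonFive F Q) = Set.range (fun c : ℂ => c • G) := by
  rintro F ⟨hF, hs, G, hG, hGs⟩
  have hF' : F.IsHomogeneous 3 := (mem_homogeneousSubmodule _ _).1 hF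
  have hG3 : G.IsHomogeneous 3 := (mem_homogeneousSubmodule _ _).1 hG.1
  obtain ⟨φ, h1, h2, h3⟩ := duality F hF' hs
  obtain ⟨Q0, hQ0, hQG⟩ := exists_Q0 F G φ h3 hG
  have hae := ae_smoothCI hF' hs hQ0
  have hop := open_smooth (fun a b => assocCubic φ (X a * X b)) hG3
    (fun a b => assocCubic_hom φ _) hGs
  obtain ⟨U, hU, hUo, hU0⟩ := mem_nhds_iff.1 hop
  obtain ⟨N, hNU, hN⟩ := (MeasureTheory.Measure.dense_of_ae hae).inter_open_nonempty U hUo ⟨0, hU0⟩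
  have hsm : SmoothForm (assocCubic φ (QN Q0 N)) := by
    have h4 : assocCubic φ (QN Q0 N) =
        G + ∑ a, ∑ b, N a b • assocCubic φ (X a * X b) := by
      simp only [QN, map_add, map_sum, map_smul, hQG]
    rw [h4]
    exact hU hNU
  refine ⟨QN Q0 N, (mem_homogeneousSubmodule _ _).2 (QN_hom hQ0 N), hN,
    assocCubic φ (QN Q0 N), hsm, smooth_ne_zero hsm, ?_⟩
  exact perp_colon F _ (QN_hom hQ0 N) φ h1 h2 (smooth_ne_zero hsm)
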